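/- arXiv:2605.08602 — 2 statements merged into one kernel-verified Lean document; each statement's English description precedes it below -/
import Mathlib

section
/- Let x ∈ Σ_ι[λ]. Then for all 1 ≤ i ≤ n and 1 ≤ j ≤ n, σ_{(j−1)n+i}(x) = Σ_{k=j}^{n} ( (Λ_{i+1}^{(k)}(x) − Λ_{i+2}^{(k)}(x)) − (Λ_i^{(k+1)}(x) − Λ_{i+1}^{(k+1)}(x)) ). -/
namespace PolyReal

/-- Cartan integers `⟨α_s^∨, α_t⟩` of type `A_n`. -/
def coef (s t : ℕ) : ℤ :=
  if s = t then 2 else if s + 1 = t ∨ t + 1 = s then -1 else 0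

/-- Colour of position `k ≥ 1` for the periodic sequence `ι = (…, n, …, 2, 1)`:
position `k = (j-1)n + i` has colour `i`. -/
def col (n k : ℕ) : ℕ := (k - 1) % n + 1

/-- The component `x_j^{(i)} = x_{(j-1)n+i}`, with the conventions
`x_j^{(0)} := 0` and `x_j^{(n+1)} := 0` (indices out of `1 ≤ i ≤ n` give `0`). -/
def Xc (n : ℕ) (x : ℕ → ℤ) (i j : ℕ) : ℤ :=
  if 1 ≤ i ∧ i ≤ n ∧ 1 ≤ j then x ((j - 1) * n + i) else 0

/-- Membership in `Σ_ι`: the chains `x_1^{(i)} ≥ x_2^{(i-1)} ≥ ⋯ ≥ x_i^{(1)} ≥ 0`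
for `1 ≤ i ≤ n`, together with `x_j^{(i)} = 0` for `i + j > n + 1`
(and `x 0 = 0`, since sequences are indexed by positions `k ≥ 1`). -/
def InSigma (n : ℕ) (x : ℕ → ℤ) : Prop :=
  x 0 = 0 ∧
  (∀ i k, 1 ≤ i → i ≤ n → 1 ≤ k → k ≤ i →
    Xc n x (i - k) (k + 1) ≤ Xc n x (i + 1 - k) k) ∧
  (∀ i j, 1 ≤ i → i ≤ n → 1 ≤ j → n + 1 < i + j → Xc n x i j = 0)

/-- Membership in `Σ_ι[λ]`. -/
def InSigmaL (n : ℕ) (lam : ℕ → ℤ) (x : ℕ → ℤ) : Prop :=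
  InSigma n x ∧
  ∀ i j, 1 ≤ j → j ≤ i → i ≤ n →
    Xc n x (i - j + 1) j - Xc n x (i - j) j ≤ lam i - lam (i + 1)

/-- Hypotheses on `λ`: `λ_1 ≥ λ_2 ≥ ⋯ ≥ λ_n (≥ 0)` and `λ_{n+1} = 0`. -/
def IsShape (n : ℕ) (lam : ℕ → ℤ) : Prop :=
  (∀ i, 1 ≤ i → i ≤ n → lam (i + 1) ≤ lam i) ∧ lam (n + 1) = 0

/-- `σ_k(x) = x_k + Σ_{l>k} ⟨α_{i_k}^∨, α_{i_l}⟩ x_l`.  For every sequence occurring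
below the support is contained in positions `≤ n²`, so the sum may be truncated
at `n² + n`. -/
def sig (n : ℕ) (x : ℕ → ℤ) (k : ℕ) : ℤ :=
  x k + ∑ l ∈ Finset.Ioc k (n * n + n), coef (col n k) (col n l) * x l

/-- `σ^{(i)}(x) = max_{k : i_k = i} σ_k(x)`; for the sequences considered here this
maximum is attained among the positions `(j-1)n + i` with `1 ≤ j ≤ n+1`
(`σ` vanishes at all later positions of colour `i`). -/
def sigmaI (n : ℕ) (x : ℕ → ℤ) (i : ℕ) : ℤ :=
  Finset.sup' (Finset.Icc 1 (n + 1)) (Finset.nonempty_Icc.mpr (by omega))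
    (fun j => sig n x ((j - 1) * n + i))

/-- `M^{(i)}(x) = { k : i_k = i, σ_k(x) = σ^{(i)}(x) }`. -/
def Mset (n : ℕ) (x : ℕ → ℤ) (i : ℕ) : Set ℕ :=
  {k | 1 ≤ k ∧ col n k = i ∧ sig n x k = sigmaI n x i}

/-- `σ_0^{(i)}(x) = -(λ_i - λ_{i+1}) + Σ_{l ≥ 1} ⟨α_i^∨, α_{i_l}⟩ x_l`
(again with the sum truncated beyond the support). -/
def sigma0 (n : ℕ) (lam : ℕ → ℤ) (x : ℕ → ℤ) (i : ℕ) : ℤ :=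
  -(lam i - lam (i + 1)) + ∑ l ∈ Finset.Icc 1 (n * n + n), coef i (col n l) * x l

/-- The elementary sequence `e_k`. -/
def eVec (k : ℕ) : ℕ → ℤ := fun l => if l = k then 1 else 0

/-- `Λ_i^{(k)}(x) = x_k^{(i-1)} + λ_{k+i-1}`, set to `0` when `k > n+2-i`. -/
def Lam (n : ℕ) (lam : ℕ → ℤ) (x : ℕ → ℤ) (i k : ℕ) : ℤ :=
  if 1 ≤ k ∧ k ≤ n + 2 - i then Xc n x (i - 1) k + lam (k + i - 1) else 0

/-- A z-array: a family of nonnegative integers indexed by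
`1 ≤ m ≤ n`, `1 ≤ k ≤ n+1-m` (and `0` outside this index range). -/
def IsZArray (n : ℕ) (Z : ℕ → ℕ → ℤ) : Prop :=
  (∀ m k, 1 ≤ m → m ≤ n → 1 ≤ k → k ≤ n + 1 - m → 0 ≤ Z m k) ∧
  (∀ m k, ¬(1 ≤ m ∧ m ≤ n ∧ 1 ≤ k ∧ k ≤ n + 1 - m) → Z m k = 0)

/-- `ψ_∞(Z)`: the sequence with `x_j^{(i)} = Σ_{k=1}^{i} z(n+2-i-j, k)` for
`i + j ≤ n+1` and `x_j^{(i)} = 0` for `i + j > n+1`.  (For a position `p ≥ 1`,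
`i = (p-1) % n + 1` and `j = (p-1)/n + 1`.) -/
def psiInf (n : ℕ) (Z : ℕ → ℕ → ℤ) : ℕ → ℤ := fun p =>
  if p = 0 then 0
  else if (p - 1) % n + 1 + ((p - 1) / n + 1) ≤ n + 1 then
    ∑ k ∈ Finset.Icc 1 ((p - 1) % n + 1),
      Z (n + 2 - ((p - 1) % n + 1) - ((p - 1) / n + 1)) k
  else 0

/-- Reverse semistandard Young tableaux of shape `λ` with entries in `{1, …, n+1}`:
row `j` (for `1 ≤ j ≤ n`) has boxes in columns `1, …, λ_j`; entries are weakly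
decreasing along rows and strictly decreasing down columns; `T` is `0` outside
the diagram. -/
def IsRSSYT (n : ℕ) (lam : ℕ → ℤ) (T : ℕ → ℕ → ℕ) : Prop :=
  (∀ j c : ℕ, 1 ≤ j → j ≤ n → 1 ≤ c → (c : ℤ) ≤ lam j → 1 ≤ T j c ∧ T j c ≤ n + 1) ∧
  (∀ j c : ℕ, 1 ≤ j → j ≤ n → 1 ≤ c → (c : ℤ) + 1 ≤ lam j → T j (c + 1) ≤ T j c) ∧
  (∀ j c : ℕ, 1 ≤ j → j + 1 ≤ n → 1 ≤ c → (c : ℤ) ≤ lam (j + 1) → T (j + 1) c < T j c) ∧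
  (∀ j c : ℕ, ¬(1 ≤ j ∧ j ≤ n ∧ 1 ≤ c ∧ (c : ℤ) ≤ lam j) → T j c = 0)

/-- `Λ_i^{(j)}(T) = #{ c : 1 ≤ c ≤ λ_j, T(j,c) ≥ i }`, as a natural number. -/
def LamTN (lam : ℕ → ℤ) (T : ℕ → ℕ → ℕ) (i j : ℕ) : ℕ :=
  ((Finset.Icc 1 (lam j).toNat).filter (fun c => i ≤ T j c)).card

/-- `Λ_i^{(j)}(T)`, as an integer. -/
def LamT (lam : ℕ → ℤ) (T : ℕ → ℕ → ℕ) (i j : ℕ) : ℤ := (LamTN lam T i j : ℤ)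

/-- The number of boxes of `T` containing the entry `i`. -/
def countEntry (n : ℕ) (lam : ℕ → ℤ) (T : ℕ → ℕ → ℕ) (i : ℕ) : ℤ :=
  ∑ j ∈ Finset.Icc 1 n,
    (((Finset.Icc 1 (lam j).toNat).filter (fun c => T j c = i)).card : ℤ)

/-- Gelfand–Tsetlin patterns of shape `λ`: `g i k` is `y_k^{(i)}`, defined for
`0 ≤ i ≤ n`, `1 ≤ k ≤ n+1-i` (and `0` outside this index range), with
`y_k^{(0)} = λ_k` and the interlacing inequalities. -/
def IsGT (n : ℕ) (lam : ℕ → ℤ) (g : ℕ → ℕ → ℤ) : Prop :=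
  (∀ i k, i ≤ n → 1 ≤ k → k ≤ n + 1 - i → 0 ≤ g i k) ∧
  (∀ k, 1 ≤ k → k ≤ n + 1 → g 0 k = lam k) ∧
  (∀ i k, 1 ≤ i → i ≤ n → 1 ≤ k → k ≤ n + 1 - i →
    g i k ≤ g (i - 1) k ∧ g (i - 1) (k + 1) ≤ g i k) ∧
  (∀ i k, ¬(i ≤ n ∧ 1 ≤ k ∧ k ≤ n + 1 - i) → g i k = 0)

/-- `ς_λ(g)`: the sequence with `x_j^{(i)} = y_j^{(i)} - λ_{i+j}` for
`1 ≤ i ≤ n`, `1 ≤ j ≤ n+1-i`, and `0` otherwise. -/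
def varsig (n : ℕ) (lam : ℕ → ℤ) (g : ℕ → ℕ → ℤ) : ℕ → ℤ := fun p =>
  if p = 0 then 0
  else if (p - 1) % n + 1 + ((p - 1) / n + 1) ≤ n + 1 then
    g ((p - 1) % n + 1) ((p - 1) / n + 1) - lam ((p - 1) % n + 1 + ((p - 1) / n + 1))
  else 0

/-- `σ_j^{(i)}(g) = y_j^{(i)} + 2 Σ_{k=j+1}^{n+1-i} y_k^{(i)} - Σ_{k=j}^{n-i} y_k^{(i+1)}
- Σ_{k=j+1}^{n+2-i} y_k^{(i-1)}`, with the conventions `y_0^{(i)} = 0` and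
out-of-range entries equal to `0`. -/
def sigGT (n : ℕ) (g : ℕ → ℕ → ℤ) (i j : ℕ) : ℤ :=
  (if 1 ≤ j ∧ j ≤ n + 1 - i then g i j else 0)
  + 2 * ∑ k ∈ Finset.Icc (j + 1) (n + 1 - i), g i k
  - ∑ k ∈ Finset.Icc (max j 1) (n - i), g (i + 1) k
  - ∑ k ∈ Finset.Icc (j + 1) (n + 2 - i), g (i - 1) k

/-- The array obtained from `g` by replacing `y_v^{(i)}` with `y_v^{(i)} + d`. -/
def gUpdate (g : ℕ → ℕ → ℤ) (i v : ℕ) (d : ℤ) : ℕ → ℕ → ℤ :=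
  fun i' k => if i' = i ∧ k = v then g i v + d else g i' k

/-- The z-array `Z_g` associated with `g ∈ GT_λ`:
`z(m,k) = y_{n+2-m-k}^{(k)} - y_{n+3-m-k}^{(k-1)}`. -/
def Zg (n : ℕ) (g : ℕ → ℕ → ℤ) (m k : ℕ) : ℤ :=
  if 1 ≤ m ∧ m ≤ n ∧ 1 ≤ k ∧ k ≤ n + 1 - m then
    g k (n + 2 - m - k) - g (k - 1) (n + 3 - m - k)
  else 0

/-- The expression `x_j^{(i)} - x_j^{(i+1)} + 2 Σ_{k=j+1}^{n+1-i} x_k^{(i)}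
- Σ_{k=j+1}^{n+2-i} x_k^{(i-1)} - Σ_{k=j+1}^{n-i} x_k^{(i+1)}`
(with `x^{(0)} = x^{(n+1)} = 0`). -/
def sigExpr (n : ℕ) (x : ℕ → ℤ) (i j : ℕ) : ℤ :=
  Xc n x i j - Xc n x (i + 1) j
  + 2 * ∑ k ∈ Finset.Icc (j + 1) (n + 1 - i), Xc n x i k
  - ∑ k ∈ Finset.Icc (j + 1) (n + 2 - i), Xc n x (i - 1) k
  - ∑ k ∈ Finset.Icc (j + 1) (n - i), Xc n x (i + 1) k

lemma aux_col (n a c : ℕ) (h1 : 1 ≤ c) (h2 : c ≤ n) : col n (a * n + c) = c := by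
  unfold col
  obtain ⟨m, rfl⟩ : ∃ m, c = m + 1 := ⟨c - 1, by omega⟩
  have : a * n + (m + 1) - 1 = m + n * a := by rw [mul_comm]; omega
  rw [this, Nat.add_mul_mod_self_left, Nat.mod_eq_of_lt (by omega)]

lemma aux_shift (f : ℕ → ℤ) (b u v : ℕ) :
    ∑ l ∈ Finset.Ioc (b + u) (b + v), f l = ∑ c ∈ Finset.Ioc u v, f (b + c) := by
  rw [← Finset.sum_image (s := Finset.Ioc u v) (g := fun c => b + c) (f := f)]
  · congr 1
    ext l
    simp only [Finset.mem_Ioc, Finset.mem_image]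
    constructor
    · rintro ⟨h1, h2⟩
      exact ⟨l - b, by omega, by omega⟩
    · rintro ⟨c, h, rfl⟩
      omega
  · intro a _ b' _ h
    simpa using h

lemma aux_coef (i c : ℕ) (y : ℤ) : coef i c * y =
    (if c = i then 2 * y else 0) + (if c = i + 1 then -y else 0)
      + (if c + 1 = i then -y else 0) := by
  unfold coef
  split_ifs <;> first | omega | simp

lemma aux_block (n a i : ℕ) (x : ℕ → ℤ) (hi1 : 1 ≤ i) (hin : i ≤ n) :
    ∑ l ∈ Finset.Ioc (a * n + i) ((a + 1) * n + i), coef i (col n l) * x l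
      = 2 * x ((a + 1) * n + i) - Xc n x (i + 1) (a + 1) - Xc n x (i - 1) (a + 2) := by
  have e : (a + 1) * n = a * n + n := by ring
  rw [← Finset.sum_Ioc_consecutive _ (show a * n + i ≤ (a + 1) * n + 0 by omega)
    (show (a + 1) * n + 0 ≤ (a + 1) * n + i by omega), aux_shift _ ((a + 1) * n)]
  rw [show (a + 1) * n + 0 = a * n + n by omega, aux_shift]
  have h1 : ∑ c ∈ Finset.Ioc i n, coef i (col n (a * n + c)) * x (a * n + c)
      = - Xc n x (i + 1) (a + 1) := by
    rw [Finset.sum_congr rfl (g := fun c => if c = i + 1 then - x (a * n + c) else 0)]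
    · rw [Finset.sum_ite_eq']
      unfold Xc
      simp only [Finset.mem_Ioc]
      split_ifs <;> first | omega | simp
    · intro c hc
      rw [Finset.mem_Ioc] at hc
      rw [aux_col n a c (by omega) hc.2, aux_coef, if_neg (by omega : ¬ c = i),
        if_neg (by omega : ¬ c + 1 = i)]
      simp
  have h2 : ∑ c ∈ Finset.Ioc 0 i, coef i (col n ((a + 1) * n + c)) * x ((a + 1) * n + c)
      = 2 * x ((a + 1) * n + i) - Xc n x (i - 1) (a + 2) := by
    rw [Finset.sum_congr rfl (g := fun c => (if c = i then 2 * x ((a + 1) * n + c) else 0)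
      + (if c = i - 1 then - x ((a + 1) * n + c) else 0))]
    · rw [Finset.sum_add_distrib, Finset.sum_ite_eq', Finset.sum_ite_eq']
      unfold Xc
      simp only [Finset.mem_Ioc]
      rw [if_pos (by omega)]
      rw [show a + 2 - 1 = a + 1 by omega]
      split_ifs <;> first | omega | ring
    · intro c hc
      rw [Finset.mem_Ioc] at hc
      rw [aux_col n (a + 1) c (by omega) (by omega), aux_coef, if_neg (by omega : ¬ c = i + 1)]
      simp only [show (c + 1 = i) = (c = i - 1) from propext (by omega)]
      ring
  rw [h1, h2]
  ring

lemma aux_term (n : ℕ) (lam x : ℕ → ℤ)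
    (hz : ∀ i j, 1 ≤ i → i ≤ n → 1 ≤ j → n + 1 < i + j → Xc n x i j = 0)
    (i k : ℕ) (hi1 : 1 ≤ i) (hin : i ≤ n) (hk : 1 ≤ k) :
    ((Lam n lam x (i + 1) k - Lam n lam x (i + 2) k)
          - (Lam n lam x i (k + 1) - Lam n lam x (i + 1) (k + 1)))
      = Xc n x i k - Xc n x (i + 1) k - Xc n x (i - 1) (k + 1) + Xc n x i (k + 1) := by
  have hz' : ∀ i j, 1 ≤ j → n + 1 < i + j → Xc n x i j = 0 := by
    intro i j hj h
    by_cases h1 : 1 ≤ i ∧ i ≤ n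
    · exact hz i j h1.1 h1.2 hj h
    · unfold Xc
      rw [if_neg (by omega)]
  have hL : ∀ m k, m ≤ n + 1 → 1 ≤ k → Lam n lam x (m + 1) k
      = Xc n x m k + (if k + m ≤ n + 1 then lam (k + m) else 0) := by
    intro m k hm hk
    unfold Lam
    by_cases h : k + m ≤ n + 1
    · rw [if_pos (by omega), if_pos h]
      rfl
    · rw [if_neg (by omega), if_neg h, hz' m k hk (by omega)]
      rfl
  obtain ⟨m, rfl⟩ : ∃ m, i = m + 1 := ⟨i - 1, by omega⟩
  rw [hL (m + 1) k (by omega) hk, hL (m + 1 + 1) k (by omega) hk, hL m (k + 1) (by omega) (by omega),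
    hL (m + 1) (k + 1) (by omega) (by omega)]
  rw [show k + (m + 1 + 1) = k + m + 2 by ring, show k + 1 + (m + 1) = k + m + 2 by ring,
    show k + (m + 1) = k + m + 1 by ring, show k + 1 + m = k + m + 1 by ring,
    show m + 1 - 1 = m by omega]
  ring

lemma aux_main (n : ℕ) (lam x : ℕ → ℤ)
    (hz : ∀ i j, 1 ≤ i → i ≤ n → 1 ≤ j → n + 1 < i + j → Xc n x i j = 0)
    (i : ℕ) (hi1 : 1 ≤ i) (hin : i ≤ n) (d : ℕ) : ∀ a, a + d = n →
    sig n x (a * n + i) =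
      ∑ k ∈ Finset.Icc (a + 1) n,
        ((Lam n lam x (i + 1) k - Lam n lam x (i + 2) k)
          - (Lam n lam x i (k + 1) - Lam n lam x (i + 1) (k + 1))) := by
  induction d with
  | zero =>
    intro a ha
    obtain rfl : a = n := by omega
    have hx0 : ∀ c, 1 ≤ c → c ≤ a → x (a * a + c) = 0 := by
      intro c h1 h2
      have := hz c (a + 1) h1 h2 (by omega) (by omega)
      unfold Xc at this
      rw [if_pos (by omega)] at this
      exact this
    rw [Finset.Icc_eq_empty (by omega), Finset.sum_empty]
    unfold sig
    rw [hx0 i hi1 hin, aux_shift, Finset.sum_eq_zero]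
    · rfl
    · intro c hc
      rw [Finset.mem_Ioc] at hc
      rw [hx0 c (by omega) hc.2, mul_zero]
  | succ d ih =>
    intro a ha
    have ih := ih (a + 1) (by omega)
    rw [← Finset.add_sum_Ioc_eq_sum_Icc (by omega : a + 1 ≤ n)]
    rw [← Finset.Icc_add_one_left_eq_Ioc, ← ih, aux_term n lam x hz i (a + 1) hi1 hin (by omega)]
    unfold sig
    have e : (a + 1) * n = a * n + n := by ring
    have e2 : (a + 1) * n ≤ n * n := Nat.mul_le_mul_right n (by omega)
    rw [aux_col n a i hi1 hin, aux_col n (a + 1) i hi1 hin,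
      ← Finset.sum_Ioc_consecutive _ (show a * n + i ≤ (a + 1) * n + i by omega)
        (show (a + 1) * n + i ≤ n * n + n by omega), aux_block n a i x hi1 hin]
    have g1 : Xc n x i (a + 1) = x (a * n + i) := by
      unfold Xc
      rw [if_pos (by omega)]
      rfl
    have g2 : Xc n x i (a + 1 + 1) = x ((a + 1) * n + i) := by
      unfold Xc
      rw [if_pos (by omega)]
      rfl
    rw [g1, g2]
    ring

/-- for `x ∈ Σ_ι[λ]`, `1 ≤ i ≤ n` and `1 ≤ j ≤ n`,
`σ_{(j-1)n+i}(x) = Σ_{k=j}^{n} ((Λ_{i+1}^{(k)} - Λ_{i+2}^{(k)}) - (Λ_i^{(k+1)} - Λ_{i+1}^{(k+1)}))`. -/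
theorem stmt6 (n : ℕ) (hn : 1 ≤ n) (lam : ℕ → ℤ) (hlam : IsShape n lam)
    (x : ℕ → ℤ) (hx : InSigmaL n lam x)
    (i j : ℕ) (hi1 : 1 ≤ i) (hin : i ≤ n) (hj1 : 1 ≤ j) (hjn : j ≤ n) :
    sig n x ((j - 1) * n + i) =
      ∑ k ∈ Finset.Icc j n,
        ((Lam n lam x (i + 1) k - Lam n lam x (i + 2) k)
          - (Lam n lam x i (k + 1) - Lam n lam x (i + 1) (k + 1))) := by
  obtain ⟨a, rfl⟩ : ∃ a, j = a + 1 := ⟨j - 1, by omega⟩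
  exact aux_main n lam x hx.1.2.2 i hi1 hin (n - a) a (by omega)

end PolyReal
end

section
/- The map ς_λ is a bijection from the set GT_λ of Gelfand–Tsetlin patterns of shape λ onto Σ_ι[λ]. -/
namespace PolyReal

theorem Xc_varsig (n : ℕ) (lam : ℕ → ℤ) (g : ℕ → ℕ → ℤ) (i j : ℕ)
    (hi : 1 ≤ i) (hin : i ≤ n) (hj : 1 ≤ j) :
    Xc n (varsig n lam g) i j = if i + j ≤ n + 1 then g i j - lam (i + j) else 0 := by
  obtain ⟨a, rfl⟩ : ∃ a, i = a + 1 := ⟨i - 1, by omega⟩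
  obtain ⟨b, rfl⟩ : ∃ b, j = b + 1 := ⟨j - 1, by omega⟩
  have h1 : (b * n + (a + 1) - 1) % n = a := by
    have : b * n + (a + 1) - 1 = a + n * b := by rw [Nat.mul_comm]; omega
    rw [this, Nat.add_mul_mod_self_left, Nat.mod_eq_of_lt (by omega)]
  have h2 : (b * n + (a + 1) - 1) / n = b := by
    have : b * n + (a + 1) - 1 = a + n * b := by rw [Nat.mul_comm]; omega
    rw [this, Nat.add_mul_div_left _ _ (by omega), Nat.div_eq_of_lt (by omega)]
    omega
  have h3 : b * n + (a + 1) ≠ 0 := by omega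
  unfold Xc varsig
  rw [if_pos ⟨hi, hin, hj⟩, Nat.add_sub_cancel, if_neg h3, h1, h2]

theorem Xc_pos (n : ℕ) (hn : 1 ≤ n) (x : ℕ → ℤ) (p : ℕ) (hp : p ≠ 0) :
    Xc n x ((p - 1) % n + 1) ((p - 1) / n + 1) = x p := by
  have h1 := Nat.mod_lt (p - 1) (show n > 0 by omega)
  have h2 := Nat.div_add_mod' (p - 1) n
  unfold Xc
  rw [if_pos ⟨by omega, by omega, Nat.le_add_left 1 _⟩, Nat.add_sub_cancel]
  congr 1
  omega

theorem Xc_zero (n : ℕ) (x : ℕ → ℤ) (j : ℕ) : Xc n x 0 j = 0 := by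
  simp [Xc]

theorem lam_nonneg (n : ℕ) (lam : ℕ → ℤ) (hlam : IsShape n lam) :
    ∀ d k, 1 ≤ k → k + d = n + 1 → 0 ≤ lam k := by
  intro d
  induction d with
  | zero =>
    intro k _ h
    have : k = n + 1 := by omega
    rw [this, hlam.2]
  | succ d ih =>
    intro k hk h
    exact (ih (k + 1) (by omega) (by omega)).trans (hlam.1 k hk (by omega))

theorem Xc_varsig' (n : ℕ) (lam : ℕ → ℤ) (g : ℕ → ℕ → ℤ) (hg : IsGT n lam g) (i j : ℕ)
    (hj : 1 ≤ j) (h : i + j ≤ n + 1) :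
    Xc n (varsig n lam g) i j = g i j - lam (i + j) := by
  rcases Nat.eq_zero_or_pos i with rfl | hi
  · rw [Xc_zero, hg.2.1 j hj (by omega), Nat.zero_add, sub_self]
  · rw [Xc_varsig n lam g i j hi (by omega) hj, if_pos h]

theorem Xc_nonneg (n : ℕ) (x : ℕ → ℤ) (hx : InSigma n x) :
    ∀ i j, 1 ≤ j → i + j ≤ n + 1 → 0 ≤ Xc n x i j := by
  intro i
  induction i with
  | zero => intro j _ _; rw [Xc_zero]
  | succ i ih =>
    intro j hj h
    have h1 := hx.2.1 (i + j) j (by omega) (by omega) hj (by omega)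
    rw [show i + j - j = i by omega, show i + j + 1 - j = i + 1 by omega] at h1
    exact (ih (j + 1) (by omega) (by omega)).trans h1

/-- `ς_λ` is a bijection from the set `GT_λ` of Gelfand–Tsetlin
patterns of shape `λ` onto `Σ_ι[λ]`. -/
theorem stmt9 (n : ℕ) (hn : 1 ≤ n) (lam : ℕ → ℤ) (hlam : IsShape n lam) :
    Set.BijOn (varsig n lam) {g | IsGT n lam g} {x | InSigmaL n lam x} := by
  refine ⟨?_, ?_, ?_⟩
  · intro g hg
    have hg : IsGT n lam g := hg
    have key := Xc_varsig' n lam g hg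
    refine ⟨⟨by simp [varsig], ?_, ?_⟩, ?_⟩
    · intro i k hi hin hk hki
      have h := (hg.2.2.1 (i + 1 - k) k (by omega) (by omega) hk (by omega)).2
      rw [show i + 1 - k - 1 = i - k by omega] at h
      rw [key _ _ (by omega) (by omega), key _ _ hk (by omega),
        show i - k + (k + 1) = i + 1 by omega, show i + 1 - k + k = i + 1 by omega]
      linarith
    · intro i j hi hin hj h
      rw [Xc_varsig n lam g i j hi hin hj, if_neg (by omega)]
    · intro i j hj hji hin
      have h := (hg.2.2.1 (i - j + 1) j (by omega) (by omega) hj (by omega)).1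
      rw [Nat.add_sub_cancel] at h
      rw [key _ _ hj (by omega), key _ _ hj (by omega),
        show i - j + 1 + j = i + 1 by omega, show i - j + j = i by omega]
      linarith
  · intro g hg g' hg' h
    have hg : IsGT n lam g := hg
    have hg' : IsGT n lam g' := hg'
    funext i k
    by_cases hik : i ≤ n ∧ 1 ≤ k ∧ k ≤ n + 1 - i
    · have h1 := Xc_varsig' n lam g hg i k hik.2.1 (by omega)
      have h2 := Xc_varsig' n lam g' hg' i k hik.2.1 (by omega)
      rw [h] at h1
      linarith
    · rw [hg.2.2.2 i k hik, hg'.2.2.2 i k hik]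
  · intro x hx
    have hx : InSigmaL n lam x := hx
    let g : ℕ → ℕ → ℤ := fun i k =>
      if i ≤ n ∧ 1 ≤ k ∧ k ≤ n + 1 - i then Xc n x i k + lam (i + k) else 0
    have hgp : ∀ i k, i ≤ n → 1 ≤ k → k ≤ n + 1 - i → g i k = Xc n x i k + lam (i + k) :=
      fun i k h1 h2 h3 => if_pos ⟨h1, h2, h3⟩
    refine ⟨g, ⟨?_, ?_, ?_, ?_⟩, ?_⟩
    · intro i k hi hk hki
      rw [hgp i k hi hk hki]
      exact add_nonneg (Xc_nonneg n x hx.1 i k hk (by omega))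
        (lam_nonneg n lam hlam (n + 1 - (i + k)) (i + k) (by omega) (by omega))
    · intro k hk hkn
      rw [hgp 0 k (by omega) hk (by omega), Xc_zero, Nat.zero_add, zero_add]
    · intro i k hi hin hk hki
      rw [hgp i k hin hk hki, hgp (i - 1) k (by omega) hk (by omega),
        hgp (i - 1) (k + 1) (by omega) (by omega) (by omega),
        show i - 1 + (k + 1) = i + k by omega]
      have h1 := hx.2 (i - 1 + k) k hk (by omega) (by omega)
      have h2 := hx.1.2.1 (i - 1 + k) k (by omega) (by omega) hk (by omega)
      rw [show i - 1 + k - k + 1 = i by omega, show i - 1 + k - k = i - 1 by omega,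
        show i - 1 + k + 1 = i + k by omega] at h1
      rw [show i - 1 + k - k = i - 1 by omega, show i - 1 + k + 1 - k = i by omega] at h2
      constructor <;> linarith
    · intro i k h
      exact if_neg h
    · funext p
      rcases Nat.eq_zero_or_pos p with rfl | hp
      · rw [hx.1.1]; simp [varsig]
      · have hp' : p ≠ 0 := by omega
        have h1 := Nat.mod_lt (p - 1) (show n > 0 by omega)
        rw [← Xc_pos n hn x p hp', ← Xc_pos n hn (varsig n lam g) p hp',
          Xc_varsig n lam g _ _ (by omega) (by omega) (Nat.le_add_left 1 _)]
        split_ifs with h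
        · rw [hgp _ _ (by omega) (Nat.le_add_left 1 _) (by omega)]
          ring
        · rw [hx.1.2.2 _ _ (by omega) (by omega) (Nat.le_add_left 1 _) (by omega)]

end PolyReal
end
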